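/- Let (X, Y, Z, φ, V) be a solution of the Bianchi I field equations (i)-(iv) on an open interval I. Then Raychaudhuri's equation holds: θ̇ + 2μ² − (1/9)θ² + (K²/2)(3p + ρ) = 0 on I, where the shear scalar μ is defined by μ² = (1/6)(η₁² + η₂² + η₃²) + (2/9)θ². -/

import Mathlib

/-- The derivative of the logarithmic derivative `f' / f` is `f'' / f - (f' / f) ^ 2`. -/
theorem hasDerivAt_deriv_div_self {f : ℝ → ℝ} {t : ℝ} (hf : DifferentiableAt ℝ f t)
    (hf' : DifferentiableAt ℝ (deriv f) t) (h0 : f t ≠ 0) :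
    HasDerivAt (fun s => deriv f s / f s)
      (deriv (deriv f) t / f t - (deriv f t / f t) ^ 2) t := by
  refine (hf'.hasDerivAt.fun_div hf.hasDerivAt h0).congr_deriv ?_
  field_simp

/-- Raychaudhuri's equation (3.2) for a Bianchi I solution:
`θ̇ + 2μ² − (1/9)θ² + (K²/2)(3p + ρ) = 0`, with
`μ² = (1/6)(η₁² + η₂² + η₃²) + (2/9)θ²`. -/
theorem stmt_7
    (K a b : ℝ) (hK : 0 < K)
    (X Y Z φ : ℝ → ℝ) (V : ℝ → ℝ)
    (hX1 : ∀ t ∈ Set.Ioo a b, DifferentiableAt ℝ X t)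
    (hX2 : ∀ t ∈ Set.Ioo a b, DifferentiableAt ℝ (deriv X) t)
    (hY1 : ∀ t ∈ Set.Ioo a b, DifferentiableAt ℝ Y t)
    (hY2 : ∀ t ∈ Set.Ioo a b, DifferentiableAt ℝ (deriv Y) t)
    (hZ1 : ∀ t ∈ Set.Ioo a b, DifferentiableAt ℝ Z t)
    (hZ2 : ∀ t ∈ Set.Ioo a b, DifferentiableAt ℝ (deriv Z) t)
    (hφ1 : ∀ t ∈ Set.Ioo a b, DifferentiableAt ℝ φ t)
    (hφ2 : ∀ t ∈ Set.Ioo a b, DifferentiableAt ℝ (deriv φ) t)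
    (hXpos : ∀ t ∈ Set.Ioo a b, 0 < X t)
    (hYpos : ∀ t ∈ Set.Ioo a b, 0 < Y t)
    (hZpos : ∀ t ∈ Set.Ioo a b, 0 < Z t)
    (ρ p : ℝ → ℝ)
    (hρ : ∀ t, ρ t = (deriv φ t) ^ 2 / 2 + V (φ t))
    (hp : ∀ t, p t = (deriv φ t) ^ 2 / 2 - V (φ t))
    (heqi : ∀ t ∈ Set.Ioo a b, (deriv X t / X t) * (deriv Y t / Y t) + (deriv X t / X t) * (deriv Z t / Z t) + (deriv Y t / Y t) * (deriv Z t / Z t) = K ^ 2 * ρ t)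
    (heqii : ∀ t ∈ Set.Ioo a b, deriv (deriv X) t / X t + deriv (deriv Y) t / Y t + (deriv X t / X t) * (deriv Y t / Y t) = -(K ^ 2 * p t))
    (heqiii : ∀ t ∈ Set.Ioo a b, deriv (deriv X) t / X t + deriv (deriv Z) t / Z t + (deriv X t / X t) * (deriv Z t / Z t) = -(K ^ 2 * p t))
    (heqiv : ∀ t ∈ Set.Ioo a b, deriv (deriv Y) t / Y t + deriv (deriv Z) t / Z t + (deriv Y t / Y t) * (deriv Z t / Z t) = -(K ^ 2 * p t))
    (θ : ℝ → ℝ)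
    (hθ : ∀ t ∈ Set.Ioo a b, θ t = deriv X t / X t + deriv Y t / Y t + deriv Z t / Z t)
    (η₁ η₂ η₃ : ℝ → ℝ)
    (hη₁ : ∀ t ∈ Set.Ioo a b, η₁ t = deriv X t / X t - deriv Y t / Y t)
    (hη₂ : ∀ t ∈ Set.Ioo a b, η₂ t = deriv X t / X t - deriv Z t / Z t)
    (hη₃ : ∀ t ∈ Set.Ioo a b, η₃ t = deriv Y t / Y t - deriv Z t / Z t)
    (μsq : ℝ → ℝ)
    (hμ : ∀ t ∈ Set.Ioo a b, μsq t = 1 / 6 * (η₁ t ^ 2 + η₂ t ^ 2 + η₃ t ^ 2) + 2 / 9 * θ t ^ 2)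
    :
    ∀ t ∈ Set.Ioo a b,
      deriv θ t + 2 * μsq t - 1 / 9 * θ t ^ 2 + K ^ 2 / 2 * (3 * p t + ρ t) = 0 := by
  intro t ht
  have hθ' : deriv θ t =
      (deriv (deriv X) t / X t - (deriv X t / X t) ^ 2) +
      (deriv (deriv Y) t / Y t - (deriv Y t / Y t) ^ 2) +
      (deriv (deriv Z) t / Z t - (deriv Z t / Z t) ^ 2) := by
    have hsum := ((hasDerivAt_deriv_div_self (hX1 t ht) (hX2 t ht) (hXpos t ht).ne').fun_add
      (hasDerivAt_deriv_div_self (hY1 t ht) (hY2 t ht) (hYpos t ht).ne')).fun_add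
      (hasDerivAt_deriv_div_self (hZ1 t ht) (hZ2 t ht) (hZpos t ht).ne')
    refine (hsum.congr_of_eventuallyEq ?_).deriv
    filter_upwards [Ioo_mem_nhds ht.1 ht.2] with s hs using hθ s hs
  rw [hθ', hμ t ht, hη₁ t ht, hη₂ t ht, hη₃ t ht, hθ t ht]
  linear_combination (heqii t ht + heqiii t ht + heqiv t ht - heqi t ht) / 2
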